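/- Let (D, ~, f) be a finite connected colored graph with B and R both nonempty, let ε > 0 and 0 ≤ δ < 1. Define the mechanism p : D → ℝ as follows: for d ∈ B with Δ = dist(d, ∂B), set 1 − p(d) = max{ (e^ε − 1 − δ(e^{ε(Δ+1)} + e^{εΔ} − 2)) / (e^{εΔ}(e^ε + 1)(e^ε − 1)), 0 }; for d ∈ R with Δ = dist(d, ∂R), set p(d) = max{ (e^ε − 1 − δ(e^{ε(Δ+1)} + e^{εΔ} − 2)) / (e^{εΔ}(e^ε + 1)(e^ε − 1)), 0 }. Then 0 ≤ p(d) ≤ 1 for all d, p is balanced (on ∂B it takes the value (e^ε + δ)/(1 + e^ε) and on ∂R the value (1 − δ)/(1 + e^ε)), and p is an (ε,δ)-DP mechanism on D. -/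

import Mathlib

open Real

/-- Shortest-path distance from a vertex to a set of vertices. -/
noncomputable def distToSet {D : Type*} (G : SimpleGraph D) (d : D) (S : Set D) : ℕ :=
  sInf (G.dist d '' S)

/-- The red-probability of the optimal balanced mechanism at distance `Δ` from the
boundary of the opposite color. -/
noncomputable def balRed (ε δ : ℝ) (Δ : ℕ) : ℝ :=
  (Real.exp ε - 1 -
      δ * (Real.exp (ε * ((Δ : ℝ) + 1)) + Real.exp (ε * (Δ : ℝ)) - 2)) /
    (Real.exp (ε * (Δ : ℝ)) * (Real.exp ε + 1) * (Real.exp ε - 1))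

theorem distToSet_of_mem {D : Type*} (G : SimpleGraph D) {d : D} {S : Set D} (hd : d ∈ S) :
    distToSet G d S = 0 :=
  Nat.sInf_eq_zero.2 (Or.inl ⟨d, hd, SimpleGraph.dist_self⟩)

theorem distToSet_le_succ_of_adj {D : Type*} {G : SimpleGraph D} (hconn : G.Connected)
    {d e : D} (hde : G.Adj d e) (S : Set D) : distToSet G d S ≤ distToSet G e S + 1 := by
  rcases S.eq_empty_or_nonempty with rfl | hS
  · simp [distToSet]
  · obtain ⟨s, hs, hes⟩ := Nat.sInf_mem (hS.image (G.dist e))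
    have hds : distToSet G d S ≤ G.dist d s := Nat.sInf_le ⟨s, hs, rfl⟩
    have htri := hconn.dist_triangle (u := d) (v := e) (w := s)
    rw [SimpleGraph.dist_eq_one_iff_adj.2 hde] at htri
    unfold distToSet at hds ⊢
    omega

theorem balRed_zero {ε : ℝ} (hε : 0 < ε) (δ : ℝ) : balRed ε δ 0 = (1 - δ) / (1 + exp ε) := by
  have hE : 1 < exp ε := Real.one_lt_exp_iff.2 hε
  have h₁ : exp ε - 1 ≠ 0 := by linarith
  have h₂ : exp ε + 1 ≠ 0 := by linarith
  have h₃ : 1 + exp ε ≠ 0 := by linarith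
  simp only [balRed, Nat.cast_zero, zero_add, mul_one, mul_zero, exp_zero, one_mul]
  field_simp
  ring

theorem balRed_eq_exp_mul_succ_add {ε : ℝ} (hε : 0 < ε) (δ : ℝ) (n : ℕ) :
    balRed ε δ n = exp ε * balRed ε δ (n + 1) + δ := by
  have hE : 1 < exp ε := Real.one_lt_exp_iff.2 hε
  have h₁ : exp ε - 1 ≠ 0 := by linarith
  have h₂ : exp ε + 1 ≠ 0 := by linarith
  have hx : exp (ε * n) ≠ 0 := exp_ne_zero _
  simp only [balRed, Nat.cast_add, Nat.cast_one, mul_add, mul_one, exp_add]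
  field_simp
  ring

theorem max_balRed_antitone {ε δ : ℝ} (hε : 0 < ε) (hδ : 0 ≤ δ) :
    Antitone fun n => max (balRed ε δ n) 0 := by
  refine antitone_nat_of_succ_le fun n => max_le ?_ (le_max_right _ _)
  have hE : 1 < exp ε := Real.one_lt_exp_iff.2 hε
  rcases le_total (balRed ε δ (n + 1)) 0 with h | h
  · exact h.trans (le_max_right _ _)
  · refine le_trans ?_ (le_max_left _ _)
    rw [balRed_eq_exp_mul_succ_add hε δ n]
    nlinarith

theorem max_balRed_le {ε δ : ℝ} (hε : 0 < ε) (hδ0 : 0 ≤ δ) (hδ1 : δ < 1) (n : ℕ) :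
    max (balRed ε δ n) 0 ≤ (1 - δ) / (1 + exp ε) := by
  have h := max_balRed_antitone hε hδ0 (Nat.zero_le n)
  have h0 : 0 ≤ (1 - δ) / (1 + exp ε) := div_nonneg (by linarith) (by positivity)
  simpa only [balRed_zero hε, max_eq_left h0] using h

theorem max_balRed_le_exp_mul_add {ε δ : ℝ} (hε : 0 < ε) (hδ : 0 ≤ δ) {m n : ℕ}
    (hnm : n ≤ m + 1) : max (balRed ε δ m) 0 ≤ exp ε * max (balRed ε δ n) 0 + δ := by
  have hanti : max (balRed ε δ (m + 1)) 0 ≤ max (balRed ε δ n) 0 :=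
    max_balRed_antitone hε hδ hnm
  have hsucc : exp ε * max (balRed ε δ (m + 1)) 0 ≤ exp ε * max (balRed ε δ n) 0 := by gcongr
  refine max_le ?_ (by positivity)
  rw [balRed_eq_exp_mul_succ_add hε δ m]
  have : exp ε * balRed ε δ (m + 1) ≤ exp ε * max (balRed ε δ (m + 1)) 0 := by
    gcongr
    exact le_max_left _ _
  linarith

/-- The privacy inequality for the likely outcome follows from the one for the unlikely outcome
when the latter has probability at most `(1 - δ) / (1 + E)`. -/
theorem one_sub_le_mul_one_sub_add {E δ q q' : ℝ} (hE : 1 ≤ E) (hδ : 0 ≤ δ)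
    (hq' : q' ≤ (1 - δ) / (1 + E)) (h : q' ≤ E * q + δ) :
    1 - q ≤ E * (1 - q') + δ := by
  rw [le_div_iff₀ (by linarith)] at hq'
  have hscaled : E * (1 - q) ≤ E * (E * (1 - q') + δ) := by
    nlinarith [mul_nonneg (sub_nonneg.2 hE) (sub_nonneg.2 hq'),
      mul_nonneg (sub_nonneg.2 hE) hδ, sq_nonneg (E - 1)]
  exact le_of_mul_le_mul_left hscaled (by linarith)

/-- The explicitly defined balanced mechanism — with error probability
`max{balRed ε δ Δ, 0}` at each dataset at distance `Δ` from the boundary of its color —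
takes values in `[0,1]`, is balanced with value `(e^ε + δ)/(1 + e^ε)` on `∂B` and
`(1 − δ)/(1 + e^ε)` on `∂R`, and is an `(ε,δ)`-DP mechanism. -/
theorem optimal_balanced_mechanism_is_DP
    {D : Type*} [Fintype D] (G : SimpleGraph D) (hconn : G.Connected)
    (f : D → ℕ) (hf : ∀ d, f d = 1 ∨ f d = 2)
    (hBne : ∃ d, f d = 1) (hRne : ∃ d, f d = 2)
    (bdryB bdryR : Set D)
    (hbdryB : bdryB = {d | f d = 1 ∧ ∃ e, G.Adj d e ∧ f e = 2})
    (hbdryR : bdryR = {d | f d = 2 ∧ ∃ e, G.Adj d e ∧ f e = 1})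
    (ε δ : ℝ) (hε : 0 < ε) (hδ0 : 0 ≤ δ) (hδ1 : δ < 1)
    (p : D → ℝ)
    (hp : ∀ d, p d =
      if f d = 1 then 1 - max (balRed ε δ (distToSet G d bdryB)) 0
      else max (balRed ε δ (distToSet G d bdryR)) 0) :
    (∀ d, 0 ≤ p d ∧ p d ≤ 1) ∧
    (∀ d ∈ bdryB, p d = (exp ε + δ) / (1 + exp ε)) ∧
    (∀ d ∈ bdryR, p d = (1 - δ) / (1 + exp ε)) ∧
    (∀ d ∈ bdryB, ∀ d' ∈ bdryR, p d = 1 - p d') ∧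
    (∀ d d', G.Adj d d' →
      p d ≤ exp ε * p d' + δ ∧ 1 - p d ≤ exp ε * (1 - p d') + δ) := by
  have hE : 1 < exp ε := Real.one_lt_exp_iff.2 hε
  have ha0 : 0 ≤ (1 - δ) / (1 + exp ε) := div_nonneg (by linarith) (by positivity)
  have hsum : (exp ε + δ) / (1 + exp ε) = 1 - (1 - δ) / (1 + exp ε) := by
    field_simp
    ring
  have ha1 : (1 - δ) / (1 + exp ε) ≤ 1 := by
    rw [div_le_one (by positivity)]
    linarith
  have hpB : ∀ d, f d = 1 → p d = 1 - max (balRed ε δ (distToSet G d bdryB)) 0 :=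
    fun d hd => by rw [hp, if_pos hd]
  have hpR : ∀ d, f d = 2 → p d = max (balRed ε δ (distToSet G d bdryR)) 0 :=
    fun d hd => by rw [hp, if_neg (by omega)]
  have hB : ∀ d ∈ bdryB, p d = (exp ε + δ) / (1 + exp ε) := fun d hd => by
    rw [hpB d (hbdryB ▸ hd).1, distToSet_of_mem G hd, balRed_zero hε, max_eq_left ha0, hsum]
  have hR : ∀ d ∈ bdryR, p d = (1 - δ) / (1 + exp ε) := fun d hd => by
    rw [hpR d (hbdryR ▸ hd).1, distToSet_of_mem G hd, balRed_zero hε, max_eq_left ha0]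
  have hle := max_balRed_le hε hδ0 hδ1
  have hratio : ∀ d d' S, G.Adj d d' → max (balRed ε δ (distToSet G d S)) 0 ≤
      exp ε * max (balRed ε δ (distToSet G d' S)) 0 + δ := fun d d' S hadj =>
    max_balRed_le_exp_mul_add hε hδ0 (distToSet_le_succ_of_adj hconn hadj.symm S)
  have hcompl : ∀ d d' S, G.Adj d d' → 1 - max (balRed ε δ (distToSet G d S)) 0 ≤
      exp ε * (1 - max (balRed ε δ (distToSet G d' S)) 0) + δ := fun d d' S hadj =>
    one_sub_le_mul_one_sub_add hE.le hδ0 (hle _) (hratio d' d S hadj.symm)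
  have hcross : 1 - (1 - δ) / (1 + exp ε) ≤ exp ε * ((1 - δ) / (1 + exp ε)) + δ := by
    apply le_of_eq
    field_simp
    ring
  have hcross' : (1 - δ) / (1 + exp ε) ≤ exp ε * (1 - (1 - δ) / (1 + exp ε)) + δ := by
    nlinarith [mul_nonneg (sub_nonneg.2 hE.le) (sub_nonneg.2 ha1),
      mul_div_cancel₀ (1 - δ) (show 1 + exp ε ≠ 0 by positivity)]
  refine ⟨fun d => ?_, hB, hR, fun d hd d' hd' => by rw [hB d hd, hR d' hd', hsum],
    fun d d' hadj => ?_⟩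
  · rcases hf d with hd | hd
    · rw [hpB d hd]
      have h0 := le_max_right (balRed ε δ (distToSet G d bdryB)) 0
      have h1 := hle (distToSet G d bdryB)
      constructor <;> linarith
    · rw [hpR d hd]
      exact ⟨le_max_right _ _, (hle _).trans ha1⟩
  · rcases hf d with hd | hd <;> rcases hf d' with hd' | hd'
    · rw [hpB d hd, hpB d' hd', sub_sub_cancel, sub_sub_cancel]
      exact ⟨hcompl d d' _ hadj, hratio d d' _ hadj⟩
    · rw [hB d (hbdryB ▸ ⟨hd, d', hadj, hd'⟩), hR d' (hbdryR ▸ ⟨hd', d, hadj.symm, hd⟩), hsum,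
        sub_sub_cancel]
      exact ⟨hcross, hcross'⟩
    · rw [hR d (hbdryR ▸ ⟨hd, d', hadj, hd'⟩), hB d' (hbdryB ▸ ⟨hd', d, hadj.symm, hd⟩), hsum,
        sub_sub_cancel]
      exact ⟨hcross', hcross⟩
    · rw [hpR d hd, hpR d' hd']
      exact ⟨hratio d d' _ hadj, hcompl d d' _ hadj⟩
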